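/- Let k ∈ ℕ and l ∈ ℕ with l ≥ 1, and on the circle S^1 consider the probability densities g_k(θ) = (1 + cos^k θ)/V_k and h_l(θ) = (1 + sin^l θ)/V_l on [−π,π], where V_j = ∫_{−π}^{π} (1 + cos^j θ) dθ. Then the variance of the sum of the corresponding independent random variables, V = 2 − 2 ∫_{−π}^{π} ∫_{−π}^{π} cos θ · g_k(θ′) h_l(θ − θ′) dθ′ dθ, equals 2; equivalently, V = (2(V(g_k) + V(h_l)) − V(g_k)·V(h_l))/2, where V(g_k) = 2 − 2∫_{−π}^{π} cos θ · g_k(θ) dθ and V(h_l) = 2 − 2∫_{−π}^{π} cos θ · h_l(θ) dθ = 2. -/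

import Mathlib

open MeasureTheory Real

/-- A `2π`-periodic function that is odd under the reflection `θ ↦ π - θ` has zero integral
over a period. -/
theorem integral_eq_zero_of_periodic_of_reflect {F : ℝ → ℝ} (hper : Function.Periodic F (2 * π))
    (hrefl : ∀ θ, F (π - θ) = -F θ) : ∫ θ in (-π)..π, F θ = 0 := by
  have hsub : ∫ θ in (-π)..π, F (π - θ) = ∫ θ in (0)..(2 * π), F θ := by
    rw [intervalIntegral.integral_comp_sub_left F π]
    congr 1 <;> ring
  have hshift := hper.intervalIntegral_add_eq 0 (-π)
  rw [zero_add, show -π + 2 * π = π by ring] at hshift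
  simp only [hrefl, intervalIntegral.integral_neg] at hsub
  linarith

/-- On the circle `S^1`, the variance of the sum of independent random variables
with densities `g_k(θ) = (1 + cos^k θ)/V_k` and `h_l(θ) = (1 + sin^l θ)/V_l`
equals `2`, which also equals `(2(V(g_k)+V(h_l)) − V(g_k)V(h_l))/2`. -/
theorem variance_sum_gk_hl_circle (k l : ℕ) (hl : 1 ≤ l)
    (Vk Vl : ℝ)
    (hVk : Vk = ∫ θ in (-π)..π, (1 + Real.cos θ ^ k))
    (hVl : Vl = ∫ θ in (-π)..π, (1 + Real.cos θ ^ l))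
    (gk hl' : ℝ → ℝ)
    (hgk : ∀ θ, gk θ = (1 + Real.cos θ ^ k) / Vk)
    (hhl : ∀ θ, hl' θ = (1 + Real.sin θ ^ l) / Vl)
    (V Vgk Vhl : ℝ)
    (hV : V = 2 - 2 * ∫ θ in (-π)..π, ∫ θ' in (-π)..π,
        Real.cos θ * (gk θ' * hl' (θ - θ')))
    (hVgk : Vgk = 2 - 2 * ∫ θ in (-π)..π, Real.cos θ * gk θ)
    (hVhl : Vhl = 2 - 2 * ∫ θ in (-π)..π, Real.cos θ * hl' θ) :
    V = 2 ∧ Vhl = 2 ∧ V = (2 * (Vgk + Vhl) - Vgk * Vhl) / 2 := by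
  have hper : Function.Periodic hl' (2 * π) := fun θ => by
    simp only [hhl, Real.sin_add_two_pi]
  have hrefl : ∀ θ, hl' (π - θ) = hl' θ := fun θ => by
    simp only [hhl, Real.sin_pi_sub]
  have heven : ∀ θ, gk (-θ) = gk θ := fun θ => by
    simp only [hgk, Real.cos_neg]
  have hmean : ∫ θ in (-π)..π, Real.cos θ * hl' θ = 0 := by
    apply integral_eq_zero_of_periodic_of_reflect
    · intro θ
      simp only [Real.cos_add_two_pi, hper θ]
    · intro θ
      simp only [hrefl, Real.cos_pi_sub, neg_mul]
  have hconv : ∫ θ in (-π)..π, ∫ θ' in (-π)..π,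
      Real.cos θ * (gk θ' * hl' (θ - θ')) = 0 := by
    apply integral_eq_zero_of_periodic_of_reflect
    · intro θ
      simp only [Real.cos_add_two_pi, add_sub_right_comm, hper _]
    · intro θ
      have hneg := intervalIntegral.integral_comp_neg (a := -π) (b := π)
        fun θ' => Real.cos (π - θ) * (gk θ' * hl' (π - θ - θ'))
      rw [neg_neg] at hneg
      rw [← hneg, ← intervalIntegral.integral_neg]
      refine intervalIntegral.integral_congr fun θ' _ => ?_
      simp only [heven, Real.cos_pi_sub, neg_mul,
        show π - θ - -θ' = π - (θ - θ') by ring, hrefl]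
  have hV2 : V = 2 := by rw [hV, hconv]; norm_num
  have hVhl2 : Vhl = 2 := by rw [hVhl, hmean]; norm_num
  exact ⟨hV2, hVhl2, by rw [hV2, hVhl2]; ring⟩
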